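/- The dual wedge DW(v,P) of a d-polytope P at a vertex v is a simplicial polytope if and only if P is simplicial, and DW(v,P) is a (d+1)-simplex if and only if P is a d-simplex. -/

import Mathlib

open Module

variable {E : Type*} [NormedAddCommGroup E] [NormedSpace ℝ E]

/-- `F` is a (possibly improper) face of `P`: the subset of `P` where some linear
functional bounded above on `P` attains its maximum over `P`. -/
def IsFaceOf (P F : Set E) : Prop :=
  F ⊆ P ∧ ∃ (l : E →ₗ[ℝ] ℝ) (c : ℝ), (∀ x ∈ P, l x ≤ c) ∧ F = {x ∈ P | l x = c}

/-- `F` is a facet of `P`, i.e. a nonempty proper face of (affine) dimension `k`. -/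
def IsFacetOf (P F : Set E) (k : ℕ) : Prop :=
  IsFaceOf P F ∧ F.Nonempty ∧ F ≠ P ∧
    Module.finrank ℝ (affineSpan ℝ F).direction = k

/-- A vertex of `P` is an extreme point. -/
def IsVertexOf (P : Set E) (v : E) : Prop := v ∈ Set.extremePoints ℝ P

/-- The dual wedge of `P ⊂ ℝ^d` at a vertex `v`, realized in `ℝ^{d+1} = ℝ^d × ℝ`. -/
def dualWedge (P : Set E) (v : E) : Set (E × ℝ) :=
  convexHull ℝ (((fun x => (x, (0 : ℝ))) '' P) ∪ {(v, 1), (v, -1)})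

/-- `F` is a (geometric) simplex: the convex hull of an affinely independent
finite set. -/
def IsSimplexSet (F : Set E) : Prop :=
  ∃ s : Finset E, AffineIndependent ℝ (Subtype.val : {x : E // x ∈ s} → E) ∧
    F = convexHull ℝ (s : Set E)

/-- `F` is a `k`-dimensional simplex: the convex hull of `k+1` affinely
independent points. -/
def IsSimplexOfDim (F : Set E) (k : ℕ) : Prop :=
  ∃ s : Finset E, s.card = k + 1 ∧
    AffineIndependent ℝ (Subtype.val : {x : E // x ∈ s} → E) ∧ F = convexHull ℝ (s : Set E)

/-- A polytope (with facets of dimension `k`) is simplicial if all its facets are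
simplices. -/
def IsSimplicialPoly (P : Set E) (k : ℕ) : Prop :=
  ∀ F, IsFacetOf P F k → IsSimplexSet F

/-- Weight form of affine independence for finsets. -/
def WInd (s : Finset E) : Prop :=
  ∀ w : E → ℝ, ∑ x ∈ s, w x = 0 → ∑ x ∈ s, w x • x = 0 → ∀ x ∈ s, w x = 0

lemma wind_iff (s : Finset E) :
    AffineIndependent ℝ (Subtype.val : {x : E // x ∈ s} → E) ↔ WInd s := by
  classical
  constructor
  · intro h w h0 h1 x hx
    refine affineIndependent_iff.1 h Finset.univ (fun i => w i.1) ?_ ?_ ⟨x, hx⟩ (Finset.mem_univ _)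
    · rw [← h0]; exact Finset.sum_coe_sort s w
    · rw [← h1]; exact Finset.sum_coe_sort s (fun x => w x • x)
  · intro h
    rw [affineIndependent_iff]
    intro t w h0 h1 e he
    have key : ∀ x (hx : x ∈ s), (fun y => if hy : y ∈ s then
        (if (⟨y, hy⟩ : {x // x ∈ s}) ∈ t then w ⟨y, hy⟩ else 0) else 0) x
        = if (⟨x, hx⟩ : {x // x ∈ s}) ∈ t then w ⟨x, hx⟩ else 0 := by
      intro x hx; simp [hx]
    have := h (fun y => if hy : y ∈ s then
        (if (⟨y, hy⟩ : {x // x ∈ s}) ∈ t then w ⟨y, hy⟩ else 0) else 0) ?_ ?_ e.1 e.2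
    · exact (if_pos he).symm.trans ((key _ e.2).symm.trans this)
    · rw [← Finset.sum_attach]
      refine (Finset.sum_congr rfl (fun x _ => key x.1 x.2)).trans ?_
      refine Eq.trans ?_ h0
      rw [← Finset.sum_filter]
      congr 1
      ext x; simp
    · rw [← Finset.sum_attach]
      refine (Finset.sum_congr rfl (fun x _ => congrArg (· • x.1) (key x.1 x.2))).trans ?_
      refine Eq.trans ?_ h1
      simp only [ite_smul, zero_smul]
      rw [← Finset.sum_filter]
      congr 1
      ext x; simp

lemma WInd.mono {s t : Finset E} (h : WInd t) (hst : s ⊆ t) : WInd s := by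
  classical
  intro w h0 h1 x hx
  have := h (fun y => if y ∈ s then w y else 0) ?_ ?_ x (hst hx)
  · simpa [hx] using this
  · rw [← Finset.sum_filter, Finset.filter_mem_eq_inter, Finset.inter_eq_right.2 hst, h0]
  · simp only [ite_smul, zero_smul]
    rw [← Finset.sum_filter, Finset.filter_mem_eq_inter, Finset.inter_eq_right.2 hst, h1]

lemma WInd.extreme {T : Finset E} (h : WInd T) {x : E} (hx : x ∈ T) :
    x ∈ Set.extremePoints ℝ (convexHull ℝ (T : Set E)) := by
  classical
  rw [mem_extremePoints_iff_left]
  refine ⟨subset_convexHull ℝ _ hx, ?_⟩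
  rintro y hy z hz ⟨p, q, hp, hq, hpq, hxe⟩
  obtain ⟨a, ha0, ha1, ha⟩ := Finset.mem_convexHull'.1 hy
  obtain ⟨b, hb0, hb1, hb⟩ := Finset.mem_convexHull'.1 hz
  have h1 := h (fun t => p * a t + q * b t - if t = x then 1 else 0) (by
    rw [Finset.sum_sub_distrib, Finset.sum_add_distrib, ← Finset.mul_sum, ← Finset.mul_sum,
      ha1, hb1]
    simp [hx, hpq]) (by
    simp only [sub_smul, add_smul, mul_smul, ite_smul, one_smul, zero_smul]
    rw [Finset.sum_sub_distrib, Finset.sum_add_distrib, ← Finset.smul_sum, ← Finset.smul_sum,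
      ha, hb]
    simp [hx, hxe])
  have h2 : ∀ t ∈ T, t ≠ x → a t = 0 := by
    intro t ht htx
    have := h1 t ht
    simp only [htx, if_false, sub_zero] at this
    have e1 := mul_nonneg hp.le (ha0 t ht)
    have e2 := mul_nonneg hq.le (hb0 t ht)
    have : p * a t = 0 := by linarith
    rcases mul_eq_zero.1 this with h | h
    · exact absurd h hp.ne'
    · exact h
  have h3 : a x = 1 := by
    rw [← ha1, Finset.sum_eq_single_of_mem x hx h2]
  rw [← ha, Finset.sum_eq_single_of_mem x hx (fun t ht htx => by rw [h2 t ht htx, zero_smul]), h3,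
    one_smul]

/-- Faces of a convex hull. -/
lemma face_convexHull (A : Set E) (l : E →ₗ[ℝ] ℝ) (c : ℝ) (h : ∀ x ∈ A, l x ≤ c) :
    {x ∈ convexHull ℝ A | l x = c} = convexHull ℝ {x ∈ A | l x = c} := by
  apply Set.Subset.antisymm
  · have hB : convexHull ℝ {x ∈ A | l x = c} ⊆ {x | l x = c} :=
      convexHull_min (fun x hx => hx.2) (convex_hyperplane l.isLinear c)
    have hc : Convex ℝ ({x | l x < c} ∪ convexHull ℝ {x ∈ A | l x = c}) := by
      have hle : ∀ x ∈ ({x | l x < c} ∪ convexHull ℝ {x ∈ A | l x = c}), l x ≤ c := by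
        rintro x (hx | hx)
        · exact le_of_lt hx
        · exact le_of_eq (hB hx)
      rw [convex_iff_forall_pos]
      intro x hx y hy a b ha hb hab
      by_cases hxc : l x < c
      · left
        have := hle y hy
        change l (a • x + b • y) < c
        simp only [map_add, map_smul, smul_eq_mul]
        have hc : c = a * c + b * c := by rw [← add_mul, hab, one_mul]
        have e1 := mul_lt_mul_of_pos_left hxc ha
        have e2 := mul_le_mul_of_nonneg_left this hb.le
        linarith
      by_cases hyc : l y < c
      · left
        have := hle x hx
        change l (a • x + b • y) < c
        simp only [map_add, map_smul, smul_eq_mul]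
        have hc : c = a * c + b * c := by rw [← add_mul, hab, one_mul]
        have e1 := mul_le_mul_of_nonneg_left this ha.le
        have e2 := mul_lt_mul_of_pos_left hyc hb
        linarith
      right
      exact convex_convexHull ℝ _ (hx.resolve_left hxc) (hy.resolve_left hyc) ha.le hb.le hab
    rintro x ⟨hx, hxc⟩
    have := convexHull_min (t := {x | l x < c} ∪ convexHull ℝ {x ∈ A | l x = c}) (fun y hy => by
      rcases (h y hy).lt_or_eq with h' | h'
      · exact Or.inl h'
      · exact Or.inr (subset_convexHull ℝ _ ⟨hy, h'⟩)) hc hx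
    rcases this with h' | h'
    · exact absurd hxc (ne_of_lt h')
    · exact h'
  · intro x hx
    exact ⟨convexHull_mono (fun y hy => hy.1) hx,
      convexHull_min (fun x hx => hx.2) (convex_hyperplane l.isLinear c) hx⟩

lemma IsSimplexSet.face {Q : Set E} (hQ : IsSimplexSet Q) (l : E →ₗ[ℝ] ℝ) (c : ℝ)
    (h : ∀ x ∈ Q, l x ≤ c) : IsSimplexSet {x ∈ Q | l x = c} := by
  classical
  obtain ⟨s, hs, rfl⟩ := hQ
  refine ⟨s.filter (fun x => l x = c), ?_, ?_⟩
  · rw [wind_iff] at hs ⊢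
    exact hs.mono (Finset.filter_subset _ _)
  · rw [face_convexHull _ l c (fun x hx => h x (subset_convexHull ℝ _ hx))]
    simp

/-- the embedding at height zero -/
def emb (E : Type*) : E ↪ E × ℝ := ⟨fun x => (x, 0), fun x y h => by simpa using h⟩

lemma emb_apply (x : E) : emb E x = (x, (0 : ℝ)) := rfl

lemma wind_map (s : Finset E) : WInd (s.map (emb E)) ↔ WInd s := by
  constructor
  · intro h w h0 h1 x hx
    refine h (fun p => w p.1) ?_ ?_ (x, 0) (Finset.mem_map_of_mem (emb E) hx)
    · simpa [emb_apply] using h0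
    · simpa [emb_apply, Prod.ext_iff, Prod.fst_sum, Prod.snd_sum] using h1
  · intro h w h0 h1 x hx
    obtain ⟨y, hy, rfl⟩ := Finset.mem_map.1 hx
    refine h (fun p => w (p, 0)) ?_ ?_ y hy
    · simpa [emb_apply] using h0
    · simpa [emb_apply, Prod.ext_iff, Prod.fst_sum, Prod.snd_sum] using h1

lemma conv_emb (F : Set E) : convexHull ℝ ((fun x => (x, (0 : ℝ))) '' F)
    = (fun x => (x, (0 : ℝ))) '' convexHull ℝ F :=
  ((LinearMap.inl ℝ E ℝ).image_convexHull F).symm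

lemma simplex_emb (F : Set E) : IsSimplexSet ((fun x => (x, (0 : ℝ))) '' F) ↔ IsSimplexSet F := by
  classical
  constructor
  · rintro ⟨T, hT, hF⟩
    have hT0 : T = (T.image Prod.fst).map (emb E) := by
      ext p
      have hp : p ∈ T → p.2 = 0 := by
        intro hp
        have : p ∈ (fun x => (x, (0 : ℝ))) '' F := by
          rw [hF]; exact subset_convexHull ℝ _ hp
        obtain ⟨y, _, rfl⟩ := this
        rfl
      simp only [Finset.mem_map, Finset.mem_image, emb_apply]
      constructor
      · intro h
        exact ⟨p.1, ⟨p, h, rfl⟩, Prod.ext rfl (hp h).symm⟩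
      · rintro ⟨x, ⟨q, hq, rfl⟩, rfl⟩
        have : q.2 = 0 := by
          have : q ∈ (fun x => (x, (0 : ℝ))) '' F := by
            rw [hF]; exact subset_convexHull ℝ _ hq
          obtain ⟨y, _, rfl⟩ := this
          rfl
        rw [← this]; exact hq
    refine ⟨T.image Prod.fst, ?_, ?_⟩
    · rw [wind_iff] at hT ⊢
      rwa [← wind_map, ← hT0]
    · have := congrArg (fun A => (LinearMap.fst ℝ E ℝ) '' A) hF
      simp only [LinearMap.image_convexHull] at this
      rw [Finset.coe_image]
      simpa [Set.image_image] using this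
  · rintro ⟨s, hs, rfl⟩
    refine ⟨s.map (emb E), ?_, ?_⟩
    · rw [wind_iff] at hs ⊢
      rwa [wind_map]
    · rw [← conv_emb, Finset.coe_map]; rfl

/-- pyramids -/
lemma simplex_pyr (F : Set E) (hF : Convex ℝ F) (v : E) (ε : ℝ) (hε : ε ≠ 0) :
    IsSimplexSet (convexHull ℝ (((fun x => (x, (0 : ℝ))) '' F) ∪ {(v, ε)})) ↔ IsSimplexSet F := by
  classical
  constructor
  · intro h
    rw [← simplex_emb]
    have hle : ∀ x ∈ ((fun x => (x, (0 : ℝ))) '' F) ∪ {(v, ε)},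
        ((-ε) • LinearMap.snd ℝ E ℝ) x ≤ 0 := by
      rintro x (⟨y, hy, rfl⟩ | hx)
      · simp
      · rw [Set.mem_singleton_iff.1 hx]; simp; nlinarith
    have := h.face ((-ε) • LinearMap.snd ℝ E ℝ) 0 (fun x hx => 
      convexHull_min (t := {x | ((-ε) • LinearMap.snd ℝ E ℝ) x ≤ 0}) hle
        (convex_halfSpace_le (LinearMap.isLinear _) 0) hx)
    rw [face_convexHull _ _ _ hle] at this
    convert this
    have : {x ∈ ((fun x => (x, (0 : ℝ))) '' F) ∪ {(v, ε)} | ((-ε) • LinearMap.snd ℝ E ℝ) x = 0}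
        = (fun x => (x, (0 : ℝ))) '' F := by
      ext x
      constructor
      · rintro ⟨h | h, h'⟩
        · exact h
        · rw [Set.mem_singleton_iff.1 h] at h'
          simp [hε] at h'
      · rintro ⟨y, hy, rfl⟩
        exact ⟨Or.inl ⟨y, hy, rfl⟩, by simp⟩
    rw [this, conv_emb, hF.convexHull_eq]
  · rintro ⟨s, hs, rfl⟩
    have hn : ((v, ε) : E × ℝ) ∉ s.map (emb E) := by
      simp [emb_apply, hε.symm]
    refine ⟨insert (v, ε) (s.map (emb E)), ?_, ?_⟩
    · rw [wind_iff] at hs ⊢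
      intro w h0 h1
      rw [Finset.sum_insert hn] at h0 h1
      have hw : w (v, ε) = 0 := by
        have := congrArg Prod.snd h1
        simpa [emb_apply, Prod.snd_sum, hε] using this
      rw [hw, zero_add] at h0
      rw [hw, zero_smul, zero_add] at h1
      intro x hx
      rcases Finset.mem_insert.1 hx with rfl | hx
      · exact hw
      · exact (wind_map s).2 hs w h0 h1 x hx
    · rw [← conv_emb, Finset.coe_insert, Finset.coe_map, Set.union_singleton]
      apply Set.Subset.antisymm
      · refine convexHull_min (Set.insert_subset ?_ ?_) (convex_convexHull ℝ _)
        · exact subset_convexHull ℝ _ (Set.mem_insert _ _)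
        · exact convexHull_mono (Set.subset_insert _ _)
      · exact convexHull_mono (Set.insert_subset_insert (subset_convexHull ℝ _))

open Classical in
/-- vertex set of the dual wedge -/
noncomputable def liftF (T : Finset E) (v : E) : Finset (E × ℝ) :=
  insert (v, 1) (insert (v, -1) (T.map (emb E)))

lemma liftF_notMem1 (T : Finset E) (v : E) : ((v, -1) : E × ℝ) ∉ T.map (emb E) := by
  simp [emb_apply]

lemma liftF_notMem2 (T : Finset E) (v : E) [DecidableEq (E × ℝ)] :
    ((v, 1) : E × ℝ) ∉ insert ((v, -1) : E × ℝ) (T.map (emb E)) := by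
  simp [emb_apply]; norm_num

lemma liftF_card (T : Finset E) (v : E) : (liftF T v).card = T.card + 2 := by
  classical
  rw [liftF, Finset.card_insert_of_notMem (liftF_notMem2 T v),
    Finset.card_insert_of_notMem (liftF_notMem1 T v), Finset.card_map]

lemma liftF_sum {M : Type*} [AddCommMonoid M] (T : Finset E) (v : E) (f : E × ℝ → M) :
    ∑ x ∈ liftF T v, f x = f (v, 1) + (f (v, -1) + ∑ x ∈ T, f (x, 0)) := by
  classical
  rw [liftF, Finset.sum_insert (liftF_notMem2 T v), Finset.sum_insert (liftF_notMem1 T v),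
    Finset.sum_map]
  rfl

lemma mem_liftF (T : Finset E) (v : E) (p : E × ℝ) :
    p ∈ liftF T v ↔ p = (v, 1) ∨ p = (v, -1) ∨ ∃ x ∈ T, (x, 0) = p := by
  classical
  simp [liftF, emb_apply]

lemma wind_lift [DecidableEq E] (T : Finset E) (v : E) (hv : v ∉ T) :
    WInd (liftF T v) ↔ WInd (insert v T) := by
  constructor
  · intro h w h0 h1
    rw [Finset.sum_insert hv] at h0 h1
    have := h (fun p => if p.2 = 0 then w p.1 else w v / 2) (by
      rw [liftF_sum]; simp; linarith) (by
      rw [liftF_sum]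
      ext1
      · simp only [Prod.fst_add, Prod.fst_sum, Prod.smul_fst]
        simp
        rw [← add_assoc, ← add_smul, add_halves, h1]
      · simp [Prod.snd_sum])
    intro x hx
    rcases Finset.mem_insert.1 hx with rfl | hx
    · have := this (x, 1) ((mem_liftF _ _ _).2 (Or.inl rfl))
      simpa using this
    · have := this (x, 0) ((mem_liftF _ _ _).2 (Or.inr (Or.inr ⟨x, hx, rfl⟩)))
      simpa using this
  · intro h w h0 h1
    rw [liftF_sum] at h0 h1
    have e1 := congrArg Prod.fst h1
    have e2 := congrArg Prod.snd h1
    simp [Prod.fst_sum, Prod.snd_sum] at e1 e2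
    have hne : ∀ x ∈ T, x ≠ v := fun x hx h => hv (h ▸ hx)
    have := h (fun x => if x = v then w (v, 1) + w (v, -1) else w (x, 0)) (by
      rw [Finset.sum_insert hv, Finset.sum_congr rfl (fun x hx => if_neg (hne x hx)), if_pos rfl]
      linarith) (by
      rw [Finset.sum_insert hv,
        Finset.sum_congr rfl (fun x hx => by rw [if_neg (hne x hx)]), if_pos rfl, add_smul,
        add_assoc, e1])
    have hv' := this v (Finset.mem_insert_self _ _)
    simp at hv'
    intro p hp
    rcases (mem_liftF _ _ _).1 hp with rfl | rfl | ⟨x, hx, rfl⟩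
    · linarith
    · linarith
    · have := this x (Finset.mem_insert_of_mem hx)
      simpa [hne x hx] using this

lemma mid_mem {A : Set (E × ℝ)} {v : E} (h1 : (v, 1) ∈ A) (h2 : (v, -1) ∈ A) :
    ((v, 0) : E × ℝ) ∈ convexHull ℝ A := by
  have := convex_convexHull ℝ A (subset_convexHull ℝ _ h1) (subset_convexHull ℝ _ h2)
    (a := 1/2) (b := 1/2) (by norm_num) (by norm_num) (by norm_num)
  convert this using 1
  ext1
  · simp [← add_smul]; norm_num
  · simp

lemma conv_lift [DecidableEq E] (T : Finset E) (v : E) :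
    dualWedge (convexHull ℝ ((insert v T : Finset E) : Set E)) v
      = convexHull ℝ (liftF T v : Set (E × ℝ)) := by
  apply Set.Subset.antisymm
  · refine convexHull_min (Set.union_subset ?_ ?_) (convex_convexHull ℝ _)
    · rw [← conv_emb]
      refine convexHull_min ?_ (convex_convexHull ℝ _)
      rintro _ ⟨x, hx, rfl⟩
      rcases Finset.mem_insert.1 (Finset.mem_coe.1 hx) with rfl | hx
      · apply mid_mem
        · exact (mem_liftF _ _ _).2 (Or.inl rfl)
        · exact (mem_liftF _ _ _).2 (Or.inr (Or.inl rfl))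
      · exact subset_convexHull ℝ _ ((mem_liftF _ _ _).2 (Or.inr (Or.inr ⟨x, hx, rfl⟩)))
    · rintro p (rfl | rfl)
      · exact subset_convexHull ℝ _ ((mem_liftF _ _ _).2 (Or.inl rfl))
      · exact subset_convexHull ℝ _ ((mem_liftF _ _ _).2 (Or.inr (Or.inl rfl)))
  · refine convexHull_mono ?_
    intro p hp
    rcases (mem_liftF _ _ _).1 hp with rfl | rfl | ⟨x, hx, rfl⟩
    · right; simp
    · right; simp
    · left; exact ⟨x, subset_convexHull ℝ _ (by simp [hx]), rfl⟩

lemma simplex_dw (F : Set E) (hF : Convex ℝ F) (v : E) (hv : v ∈ Set.extremePoints ℝ F) (k : ℕ) :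
    IsSimplexOfDim (dualWedge F v) (k + 1) ↔ IsSimplexOfDim F k := by
  classical
  constructor
  · rintro ⟨T, hcard, hT, hDW⟩
    rw [wind_iff] at hT
    have hsub : ∀ p ∈ T, p ∈ ((fun x => (x, (0 : ℝ))) '' F) ∪ {(v, 1), (v, -1)} := by
      intro p hp
      have := hT.extreme hp
      rw [← hDW] at this
      exact extremePoints_convexHull_subset this
    have hne : ∀ δ : ℝ, (δ = 1 ∨ δ = -1) → ((v, δ) : E × ℝ) ∈ T := by
      intro δ hδ
      by_contra hn
      have hm : ((v, δ) : E × ℝ) ∈ convexHull ℝ (T : Set (E × ℝ)) := by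
        rw [← hDW]
        apply subset_convexHull
        rcases hδ with rfl | rfl <;> simp
      have := convexHull_min (t := {x | (δ • LinearMap.snd ℝ E ℝ) x ≤ 0}) (fun p hp => by
        rcases hsub p hp with ⟨x, hx, rfl⟩ | h | h
        · simp
        · subst h
          rcases hδ with rfl | rfl
          · exact absurd hp hn
          · simp
        · rw [Set.mem_singleton_iff] at h
          subst h
          rcases hδ with rfl | rfl
          · simp
          · exact absurd hp hn) (convex_halfSpace_le (LinearMap.isLinear _) 0) hm
      rcases hδ with rfl | rfl <;> simp at this <;> linarith
    set T0 : Finset E := (T.filter (fun p => p.2 = 0)).image Prod.fst with hT0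
    have hmem : ∀ x, x ∈ T0 ↔ (x, (0 : ℝ)) ∈ T := by
      intro x
      simp [hT0]
    have hTl : T = liftF T0 v := by
      ext p
      rw [mem_liftF]
      constructor
      · intro hp
        rcases hsub p hp with ⟨x, hx, rfl⟩ | h | h
        · exact Or.inr (Or.inr ⟨x, (hmem x).2 hp, rfl⟩)
        · exact Or.inl h
        · exact Or.inr (Or.inl h)
      · rintro (rfl | rfl | ⟨x, hx, rfl⟩)
        · exact hne 1 (Or.inl rfl)
        · exact hne (-1) (Or.inr rfl)
        · exact (hmem x).1 hx
    have hvT : v ∉ T0 := by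
      intro h
      have h1 := hT.extreme ((hmem v).1 h)
      rw [mem_extremePoints_iff_left] at h1
      have := h1.2 (v, 1) (subset_convexHull ℝ _ (hne 1 (Or.inl rfl))) (v, -1)
        (subset_convexHull ℝ _ (hne (-1) (Or.inr rfl)))
        ⟨1/2, 1/2, by norm_num, by norm_num, by norm_num, by
          ext1
          · simp [← add_smul]; norm_num
          · simp⟩
      simp at this
    refine ⟨insert v T0, ?_, ?_, ?_⟩
    · rw [Finset.card_insert_of_notMem hvT]
      rw [hTl, liftF_card] at hcard
      omega
    · rw [wind_iff, ← wind_lift T0 v hvT, ← hTl]; exact hT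
    · rw [hTl, ← conv_lift] at hDW
      have key : ∀ G : Set E, Convex ℝ G → v ∈ G →
          (LinearMap.fst ℝ E ℝ) '' (dualWedge G v) = G := by
        intro G hG hvG
        rw [dualWedge, LinearMap.image_convexHull, Set.image_union, Set.image_image,
          Set.image_pair]
        simp [hvG, hG.convexHull_eq]
      rw [← key F hF hv.1, hDW, key _ (convex_convexHull ℝ _)
        (subset_convexHull ℝ _ (by simp))]
  · rintro ⟨s, hcard, hs, rfl⟩
    have hvs : v ∈ s := extremePoints_convexHull_subset hv
    rw [wind_iff] at hs
    obtain ⟨T, hvT, rfl⟩ : ∃ T, v ∉ T ∧ s = insert v T :=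
      ⟨s.erase v, Finset.notMem_erase v s, (Finset.insert_erase hvs).symm⟩
    refine ⟨liftF T v, ?_, ?_, conv_lift T v⟩
    · rw [liftF_card]
      rw [Finset.card_insert_of_notMem hvT] at hcard
      omega
    · rwa [wind_iff, wind_lift T v hvT]

lemma simplex_iff_dim (F : Set E) (hF : F.Nonempty) :
    IsSimplexSet F ↔ ∃ k, IsSimplexOfDim F k := by
  constructor
  · rintro ⟨s, hs, rfl⟩
    have : s.Nonempty := by
      rw [convexHull_nonempty_iff] at hF
      exact_mod_cast hF
    exact ⟨s.card - 1, s, by have := this.card_pos; omega, hs, rfl⟩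
  · rintro ⟨k, s, _, hs, h⟩
    exact ⟨s, hs, h⟩

lemma simplex_dw' (F : Set E) (hF : Convex ℝ F) (v : E) (hv : v ∈ Set.extremePoints ℝ F) :
    IsSimplexSet (dualWedge F v) ↔ IsSimplexSet F := by
  have h1 : ((v, 1) : E × ℝ) ∈ dualWedge F v := subset_convexHull ℝ _ (by simp)
  have h2 : ((v, -1) : E × ℝ) ∈ dualWedge F v := subset_convexHull ℝ _ (by simp)
  rw [simplex_iff_dim _ ⟨_, h1⟩, simplex_iff_dim _ ⟨_, hv.1⟩]
  constructor
  · rintro ⟨_ | k, hk⟩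
    · obtain ⟨s, hs, -, h⟩ := hk
      obtain ⟨x, rfl⟩ := Finset.card_eq_one.1 hs
      rw [h] at h1 h2
      simp at h1 h2
      have := h1.trans h2.symm
      simp at this
      linarith
    · exact ⟨k, (simplex_dw F hF v hv k).1 hk⟩
  · rintro ⟨k, hk⟩
    exact ⟨k + 1, (simplex_dw F hF v hv k).2 hk⟩

/-- affine dimension -/
noncomputable def adim (F : Set E) : ℕ := Module.finrank ℝ (affineSpan ℝ F).direction

lemma adim_conv (F : Set E) : adim (convexHull ℝ F) = adim F := by
  rw [adim, affineSpan_convexHull, adim]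

lemma adim_emb (F : Set E) : adim ((fun x => (x, (0 : ℝ))) '' F) = adim F := by
  have h : (fun x : E => (x, (0 : ℝ))) '' F = (LinearMap.inl ℝ E ℝ).toAffineMap '' F := rfl
  rw [adim, adim, h, ← AffineSubspace.map_span, AffineSubspace.map_direction]
  exact (LinearEquiv.finrank_eq
    (Submodule.equivMapOfInjective (LinearMap.inl ℝ E ℝ) LinearMap.inl_injective _)).symm

lemma adim_pyr [FiniteDimensional ℝ E] (F : Set E) (hF : F.Nonempty) (v : E) (ε : ℝ)
    (hε : ε ≠ 0) : adim (((fun x => (x, (0 : ℝ))) '' F) ∪ {(v, ε)}) = adim F + 1 := by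
  obtain ⟨x, hx⟩ := hF
  have hx' : (x, (0 : ℝ)) ∈ affineSpan ℝ ((fun x => (x, (0 : ℝ))) '' F) :=
    subset_affineSpan ℝ _ ⟨x, hx, rfl⟩
  rw [← adim_emb F, adim, adim, Set.union_singleton, ← affineSpan_insert_affineSpan,
    AffineSubspace.direction_affineSpan_insert hx']
  have hle : (affineSpan ℝ ((fun x : E => (x, (0 : ℝ))) '' F)).direction
      ≤ LinearMap.ker (LinearMap.snd ℝ E ℝ) := by
    rw [direction_affineSpan, vectorSpan, Submodule.span_le]
    rintro _ ⟨_, ⟨a, _, rfl⟩, _, ⟨b, _, rfl⟩, rfl⟩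
    simp
  have hdis : Submodule.span ℝ {((v, ε) : E × ℝ) -ᵥ (x, 0)} ⊓
      (affineSpan ℝ ((fun x : E => (x, (0 : ℝ))) '' F)).direction = ⊥ := by
    rw [eq_bot_iff]
    rintro z ⟨hz1, hz2⟩
    obtain ⟨a, rfl⟩ := Submodule.mem_span_singleton.1 hz1
    have := hle hz2
    simp [hε] at this
    simp [this]
  have := Submodule.finrank_sup_add_finrank_inf_eq
    (Submodule.span ℝ {((v, ε) : E × ℝ) -ᵥ (x, 0)})
    (affineSpan ℝ ((fun x : E => (x, (0 : ℝ))) '' F)).direction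
  rw [hdis, finrank_bot, finrank_span_singleton (by simp [hε])] at this
  omega

lemma adim_dw [FiniteDimensional ℝ E] (F : Set E) (v : E) (hv : v ∈ F) :
    adim (dualWedge F v) = adim F + 1 := by
  rw [dualWedge, adim_conv, ← adim_pyr F ⟨v, hv⟩ v 1 one_ne_zero, adim, adim]
  suffices h : affineSpan ℝ (((fun x => (x, (0 : ℝ))) '' F) ∪ {(v, 1), (v, -1)})
      = affineSpan ℝ (((fun x => (x, (0 : ℝ))) '' F) ∪ {(v, 1)}) by rw [h]
  apply le_antisymm
  · rw [affineSpan_le]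
    have h0 : ((v, 0) : E × ℝ) ∈ affineSpan ℝ (((fun x => (x, (0 : ℝ))) '' F) ∪ {(v, 1)}) :=
      subset_affineSpan ℝ _ (Or.inl ⟨v, hv, rfl⟩)
    have h1 : ((v, 1) : E × ℝ) ∈ affineSpan ℝ (((fun x => (x, (0 : ℝ))) '' F) ∪ {(v, 1)}) :=
      subset_affineSpan ℝ _ (Or.inr rfl)
    rintro p (h | rfl | h)
    · exact subset_affineSpan ℝ _ (Or.inl h)
    · exact h1
    · rw [Set.mem_singleton_iff.1 h]
      have := AffineMap.lineMap_mem (-1 : ℝ) h0 h1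
      convert this using 1
      simp [AffineMap.lineMap_apply]
  · apply affineSpan_mono
    apply Set.union_subset_union_right
    simp

lemma eq_of_adim_eq [FiniteDimensional ℝ E] (F : Set E) (hF : F.Nonempty) (l : E →ₗ[ℝ] ℝ) (c : ℝ)
    (h : ∀ x ∈ F, l x = c) (hd : adim F = Module.finrank ℝ E) (v : E) : l v = c := by
  obtain ⟨x, hx⟩ := hF
  have htop : (affineSpan ℝ F).direction = ⊤ := Submodule.eq_top_of_finrank_eq hd
  have hle : (affineSpan ℝ F).direction ≤ LinearMap.ker l := by
    rw [direction_affineSpan, vectorSpan, Submodule.span_le]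
    rintro _ ⟨a, ha, b, hb, rfl⟩
    simp [h a ha, h b hb]
  have : v - x ∈ LinearMap.ker l := hle (by rw [htop]; trivial)
  rw [LinearMap.mem_ker, map_sub, h x hx] at this
  linarith

lemma simplicial_dw [FiniteDimensional ℝ E] (P : Set E) (hP : Convex ℝ P) (v : E)
    (hv : v ∈ Set.extremePoints ℝ P) (d : ℕ) (hd : Module.finrank ℝ E = d) :
    IsSimplicialPoly (dualWedge P v) d ↔ IsSimplicialPoly P (d - 1) := by
  have hconv : ∀ (l : E →ₗ[ℝ] ℝ) (c : ℝ), Convex ℝ {x ∈ P | l x = c} := fun l c =>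
    hP.inter (convex_hyperplane l.isLinear c)
  have hext : ∀ (l : E →ₗ[ℝ] ℝ) (c : ℝ), l v = c →
      v ∈ Set.extremePoints ℝ {x ∈ P | l x = c} := fun l c h =>
    inter_extremePoints_subset_extremePoints_of_subset (fun x hx => hx.1) ⟨⟨hv.1, h⟩, hv⟩
  have hsubP : ∀ x ∈ P, (x, (0 : ℝ)) ∈ dualWedge P v := fun x hx =>
    subset_convexHull ℝ _ (Or.inl ⟨x, hx, rfl⟩)
  have hsub1 : (v, (1 : ℝ)) ∈ dualWedge P v := subset_convexHull ℝ _ (by simp)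
  have hsub2 : (v, (-1 : ℝ)) ∈ dualWedge P v := subset_convexHull ℝ _ (by simp)
  -- the face of the dual wedge
  have hbd : ∀ (l : E →ₗ[ℝ] ℝ) (t c : ℝ), (∀ x ∈ P, l x ≤ c) → l v + t ≤ c → l v - t ≤ c →
      ∀ p ∈ (((fun x => (x, (0 : ℝ))) '' P) ∪ {(v, 1), (v, -1)}),
        (l.coprod (t • LinearMap.id)) p ≤ c := by
    rintro l t c h1 h2 h3 p (⟨x, hx, rfl⟩ | rfl | h)
    · simpa using h1 x hx
    · simpa using h2
    · rw [Set.mem_singleton_iff.1 h]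
      simpa [sub_eq_add_neg] using h3
  have hbd' : ∀ (l : E →ₗ[ℝ] ℝ) (t c : ℝ), (∀ x ∈ P, l x ≤ c) → l v + t ≤ c → l v - t ≤ c →
      ∀ p ∈ dualWedge P v, (l.coprod (t • LinearMap.id)) p ≤ c := by
    intro l t c h1 h2 h3 p hp
    exact convexHull_min (t := {x | (l.coprod (t • LinearMap.id)) x ≤ c}) (hbd l t c h1 h2 h3)
        (convex_halfSpace_le (LinearMap.isLinear _) c) hp
  have hface : ∀ (l : E →ₗ[ℝ] ℝ) (t c : ℝ), (∀ x ∈ P, l x ≤ c) → l v + t ≤ c → l v - t ≤ c →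
      ∀ B : Set (E × ℝ), (∀ p, p ∈ B ↔ (p = (v, 1) ∧ l v + t = c) ∨ (p = (v, -1) ∧ l v - t = c)) →
      {p ∈ dualWedge P v | (l.coprod (t • LinearMap.id)) p = c} =
        convexHull ℝ (((fun x => (x, (0 : ℝ))) '' {x ∈ P | l x = c}) ∪ B) := by
    intro l t c h1 h2 h3 B hB
    rw [dualWedge, face_convexHull _ _ _ (hbd l t c h1 h2 h3)]
    congr 1
    ext p
    constructor
    · rintro ⟨⟨x, hx, rfl⟩ | rfl | h, hc⟩
      · exact Or.inl ⟨x, ⟨hx, by simpa using hc⟩, rfl⟩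
      · exact Or.inr ((hB _).2 (Or.inl ⟨rfl, by simpa using hc⟩))
      · rw [Set.mem_singleton_iff] at h
        subst h
        exact Or.inr ((hB _).2 (Or.inr ⟨rfl, by simpa [sub_eq_add_neg] using hc⟩))
    · rintro (⟨x, ⟨hx, hc⟩, rfl⟩ | h)
      · exact ⟨Or.inl ⟨x, hx, rfl⟩, by simpa using hc⟩
      · rcases (hB _).1 h with ⟨rfl, hc⟩ | ⟨rfl, hc⟩
        · exact ⟨Or.inr (by simp), by simpa using hc⟩
        · exact ⟨Or.inr (by simp), by simpa [sub_eq_add_neg] using hc⟩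
  constructor
  · rintro H F ⟨⟨-, l, c, hle, rfl⟩, hne, hproper, hdim⟩
    have hd1 : 1 ≤ d := by
      by_contra h0
      have h0 : Module.finrank ℝ E = 0 := by omega
      have := Module.finrank_zero_iff.1 h0
      apply hproper
      ext x
      obtain ⟨y, hy⟩ := hne
      rw [Subsingleton.elim x y]
      exact ⟨fun h => h.1, fun _ => hy⟩
    rcases (hle v hv.1).eq_or_lt with hvc | hvc
    · have hf := hface l 0 c hle (by simp [hvc]) (by simp [hvc]) {(v, 1), (v, -1)}
        (by intro p; simp [hvc])
      change _ = dualWedge _ v at hf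
      rw [← simplex_dw' _ (hconv l c) v (hext l c hvc), ← hf]
      apply H
      refine ⟨⟨fun p hp => hp.1, _, c,
        hbd' l 0 c hle (by simp [hvc]) (by simp [hvc]), rfl⟩, ?_, ?_, ?_⟩
      · exact ⟨(v, 1), hsub1, by simp [hvc]⟩
      · intro heq
        apply hproper
        apply Set.Subset.antisymm (fun x hx => hx.1)
        intro x hx
        have := hsubP x hx
        rw [← heq] at this
        exact ⟨hx, by simpa using this.2⟩
      · rw [hf]
        have := adim_dw {x ∈ P | l x = c} v ⟨hv.1, hvc⟩
        unfold adim at this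
        rw [this, hdim]; omega
    · have hf := hface l (c - l v) c hle (by linarith) (by linarith) {(v, 1)} (by
        intro p
        have : ¬ (l v - (c - l v) = c) := by intro h; linarith
        simp [this])
      rw [← simplex_pyr _ (hconv l c) v 1 one_ne_zero, ← hf]
      apply H
      refine ⟨⟨fun p hp => hp.1, _, c,
        hbd' l (c - l v) c hle (by linarith) (by linarith), rfl⟩, ?_, ?_, ?_⟩
      · exact ⟨(v, 1), hsub1, by simp⟩
      · intro heq
        have := hsub2
        rw [← heq] at this
        have := this.2
        simp at this
        linarith
      · rw [hf]
        have := adim_pyr {x ∈ P | l x = c} hne v 1 one_ne_zero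
        rw [← adim_conv] at this
        unfold adim at this
        rw [this, hdim]; omega
  · rintro H G ⟨⟨-, m, c, hle, hG⟩, hne, hproper, hdim⟩
    obtain ⟨l, t, rfl⟩ : ∃ (l : E →ₗ[ℝ] ℝ) (t : ℝ), m = l.coprod (t • LinearMap.id) := by
      refine ⟨m ∘ₗ LinearMap.inl ℝ E ℝ, m (0, 1), ?_⟩
      apply LinearMap.prod_ext
      · ext x; simp
      · ext; simp
    have h1 : ∀ x ∈ P, l x ≤ c := fun x hx => by simpa using hle _ (hsubP x hx)
    have h2 : l v + t ≤ c := by simpa using hle _ hsub1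
    have h3 : l v - t ≤ c := by simpa [sub_eq_add_neg] using hle _ hsub2
    have hbad : l v < c → G = convexHull ℝ (((fun x => (x, (0 : ℝ))) '' {x ∈ P | l x = c}) ∪ ∅) →
        False := by
      intro hvc hG'
      rw [Set.union_empty] at hG'
      have hFne : {x ∈ P | l x = c}.Nonempty := by
        rw [hG', convexHull_nonempty_iff, Set.image_nonempty] at hne
        exact hne
      have hdim' : adim G = d := hdim
      rw [hG', adim_conv, adim_emb, ← hd] at hdim'
      have := eq_of_adim_eq _ hFne l c (fun x hx => hx.2) hdim' v
      linarith
    have hpyr : ∀ ε : ℝ, ε ≠ 0 → l v < c →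
        G = convexHull ℝ (((fun x => (x, (0 : ℝ))) '' {x ∈ P | l x = c}) ∪ {(v, ε)}) →
        IsSimplexSet G := by
      intro ε hε hvc hG'
      by_cases hFne : {x ∈ P | l x = c}.Nonempty
      · rw [hG', simplex_pyr _ (hconv l c) v ε hε]
        apply H
        refine ⟨⟨fun p hp => hp.1, l, c, h1, rfl⟩, hFne, ?_, ?_⟩
        · intro heq
          have := hv.1
          rw [← heq] at this
          exact absurd this.2 hvc.ne
        · have hdim' : adim G = d := hdim
          rw [hG', adim_conv, adim_pyr _ hFne v ε hε] at hdim'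
          change adim _ = _
          omega
      · rw [Set.not_nonempty_iff_eq_empty] at hFne
        rw [hFne, Set.image_empty, Set.empty_union] at hG'
        refine ⟨{(v, ε)}, ?_, by simpa using hG'⟩
        rw [wind_iff]
        intro w h0 _ x hx
        rw [Finset.mem_singleton] at hx
        subst hx
        simpa using h0
    by_cases hvc : l v = c
    · have ht : t = 0 := by linarith
      subst ht
      have hf := hface l 0 c h1 h2 h3 {(v, 1), (v, -1)} (by intro p; simp [hvc])
      change _ = dualWedge _ v at hf
      rw [← hG] at hf
      rw [hf, simplex_dw' _ (hconv l c) v (hext l c hvc)]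
      apply H
      refine ⟨⟨fun p hp => hp.1, l, c, h1, rfl⟩, ⟨v, hv.1, hvc⟩, ?_, ?_⟩
      · intro heq
        apply hproper
        rw [hf, heq]
      · have hdim' : adim G = d := hdim
        rw [hf, adim_dw {x ∈ P | l x = c} v ⟨hv.1, hvc⟩] at hdim'
        change adim _ = _
        omega
    · have hvc : l v < c := lt_of_le_of_ne (h1 v hv.1) hvc
      by_cases e1 : l v + t = c
      · have e2 : ¬ (l v - t = c) := by intro h; linarith
        exact hpyr 1 one_ne_zero hvc (hG.trans (hface l t c h1 h2 h3 _ (by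
          intro p; simp [e1, e2])))
      · by_cases e2 : l v - t = c
        · exact hpyr (-1) (by norm_num) hvc (hG.trans (hface l t c h1 h2 h3 _ (by
            intro p; simp [e1, e2])))
        · exact absurd (hG.trans (hface l t c h1 h2 h3 ∅ (by
            intro p; simp [e1, e2]))) (hbad hvc)

/-- The dual wedge `DW(v,P)` of a `d`-polytope `P` at a vertex `v`
is a simplicial polytope iff `P` is simplicial, and `DW(v,P)` is a `(d+1)`-simplex
iff `P` is a `d`-simplex. -/
theorem dualWedge_simplicial (d : ℕ) (S : Finset (EuclideanSpace ℝ (Fin d)))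
    (v : EuclideanSpace ℝ (Fin d))
    (P : Set (EuclideanSpace ℝ (Fin d))) (hP : P = convexHull ℝ (S : Set _))
    (hfull : affineSpan ℝ P = ⊤) (hv : IsVertexOf P v) :
    (IsSimplicialPoly (dualWedge P v) d ↔ IsSimplicialPoly P (d - 1)) ∧
      (IsSimplexOfDim (dualWedge P v) (d + 1) ↔ IsSimplexOfDim P d) := by
  have hc : Convex ℝ P := by rw [hP]; exact convex_convexHull ℝ _
  exact ⟨simplicial_dw P hc v hv d (by simp), simplex_dw P hc v hv d⟩
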